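/- For every complex n×n matrix M, there exists a unitary matrix R ∈ U(n) such that ‖M − R‖_{2,τ_n} ≤ ‖M*M − 1‖_{2,τ_n}, where ‖·‖_{2,τ_n} is the normalized Hilbert–Schmidt norm. -/

import Mathlib

open scoped Matrix

/-- Normalized Hilbert-Schmidt norm on n×n complex matrices. -/
noncomputable def hsnorm {n : ℕ} (A : Matrix (Fin n) (Fin n) ℂ) : ℝ :=
  Real.sqrt (((Matrix.trace (Aᴴ * A)) / (n : ℂ)).re)

open scoped ComplexOrder in
theorem svd_aux (n : ℕ) (M : Matrix (Fin n) (Fin n) ℂ) :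
    ∃ W ∈ Matrix.unitaryGroup (Fin n) ℂ, ∃ V ∈ Matrix.unitaryGroup (Fin n) ℂ, ∃ d : Fin n → ℝ,
      (∀ i, 0 ≤ d i) ∧ M * V = W * Matrix.diagonal (fun i => (d i : ℂ)) := by
  have hps := Matrix.posSemidef_conjTranspose_mul_self M
  have hA := hps.isHermitian
  set V : Matrix (Fin n) (Fin n) ℂ := (hA.eigenvectorUnitary : Matrix (Fin n) (Fin n) ℂ) with hV
  have hVm : V ∈ Matrix.unitaryGroup (Fin n) ℂ := hA.eigenvectorUnitary.2
  have hVV : Vᴴ * V = 1 := Matrix.mem_unitaryGroup_iff'.1 hVm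
  set l := hA.eigenvalues with hl
  have hl0 : ∀ i, 0 ≤ l i := hps.eigenvalues_nonneg
  have hN : (M * V)ᴴ * (M * V) = Matrix.diagonal (fun i => (l i : ℂ)) := by
    have h := hA.spectral_theorem
    rw [Unitary.conjStarAlgAut_apply] at h
    have h2 : Mᴴ * M = V * Matrix.diagonal (fun i => (l i : ℂ)) * Vᴴ := h
    rw [Matrix.conjTranspose_mul, Matrix.mul_assoc, ← Matrix.mul_assoc Mᴴ, h2]
    simp only [Matrix.mul_assoc, hVV, Matrix.mul_one]
    rw [← Matrix.mul_assoc, hVV, Matrix.one_mul]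
  set N := M * V with hNdef
  have hent : ∀ i j, ∑ k, star (N k i) * N k j = if i = j then (l i : ℂ) else 0 := by
    intro i j
    have := congrFun (congrFun hN i) j
    simpa [Matrix.mul_apply, Matrix.diagonal_apply] using this
  let v : Fin n → EuclideanSpace ℂ (Fin n) := fun j =>
    WithLp.toLp 2 (fun k => ((Real.sqrt (l j))⁻¹ : ℝ) * N k j)
  let s : Set (Fin n) := {j | l j ≠ 0}
  have hv : Orthonormal ℂ (s.domRestrict v) := by
    rw [orthonormal_iff_ite]
    rintro ⟨i, hi⟩ ⟨j, hj⟩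
    have h1 : inner ℂ (v i) (v j) = ((Real.sqrt (l i))⁻¹ : ℝ) * ((Real.sqrt (l j))⁻¹ : ℝ) *
        ∑ k, star (N k i) * N k j := by
      simp only [v, PiLp.inner_apply, RCLike.inner_apply, Finset.mul_sum, map_mul,
        Complex.conj_ofReal]
      refine Finset.sum_congr rfl fun k _ => ?_
      simp only [Complex.star_def]
      ring
    change inner ℂ (v i) (v j) = _
    rw [h1, hent]
    simp only [Subtype.mk.injEq]
    split_ifs with h
    · subst h
      have hne : Real.sqrt (l i) ≠ 0 := (Real.sqrt_ne_zero (hl0 i)).2 hi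
      have : (Real.sqrt (l i))⁻¹ * (Real.sqrt (l i))⁻¹ * l i = 1 := by
        nth_rewrite 3 [← Real.mul_self_sqrt (hl0 i)]
        field_simp
      exact_mod_cast this
    · simp
  obtain ⟨b, hb⟩ := hv.exists_orthonormalBasis_extension_of_card_eq (by simp)
  refine ⟨Matrix.of fun k j => b j k, ?_, V, hVm, fun i => Real.sqrt (l i),
    fun i => Real.sqrt_nonneg _, ?_⟩
  · rw [Matrix.mem_unitaryGroup_iff']
    ext i j
    have := orthonormal_iff_ite.1 b.orthonormal i j
    rw [PiLp.inner_apply] at this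
    simp only [Matrix.mul_apply, Matrix.star_apply, Matrix.of_apply, Matrix.one_apply, ← this,
      RCLike.inner_apply, Complex.star_def]
    exact Finset.sum_congr rfl fun k _ => mul_comm _ _
  · rw [← hNdef]
    ext k j
    rw [Matrix.mul_diagonal, Matrix.of_apply]
    by_cases hj : l j = 0
    · have h := hent j j
      simp only [if_true, hj, Complex.ofReal_zero] at h
      have h' : ∑ k, Complex.normSq (N k j) = 0 := by
        have : ((∑ k, Complex.normSq (N k j) : ℝ) : ℂ) = 0 := by
          rw [← h]
          push_cast
          exact Finset.sum_congr rfl fun k _ => Complex.normSq_eq_conj_mul_self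
        exact_mod_cast this
      have := (Finset.sum_eq_zero_iff_of_nonneg (fun k _ => Complex.normSq_nonneg _)).1 h' k
        (Finset.mem_univ _)
      rw [Complex.normSq_eq_zero] at this
      simp [this, hj]
    · rw [hb j hj]
      have hne : (Real.sqrt (l j) : ℂ) ≠ 0 := by
        exact_mod_cast (Real.sqrt_ne_zero (hl0 j)).2 hj
      simp only [v, Complex.ofReal_inv]
      field_simp

theorem trace_aux (n : ℕ) (W V : Matrix (Fin n) (Fin n) ℂ) (hW : Wᴴ * W = 1) (hV : Vᴴ * V = 1)
    (e : Fin n → ℝ) :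
    hsnorm (W * Matrix.diagonal (fun i => (e i : ℂ)) * Vᴴ) = Real.sqrt ((∑ i, e i ^ 2) / n) := by
  unfold hsnorm
  congr 1
  have h : (W * Matrix.diagonal (fun i => (e i : ℂ)) * Vᴴ)ᴴ *
      (W * Matrix.diagonal (fun i => (e i : ℂ)) * Vᴴ) =
      V * (Matrix.diagonal (fun i => ((e i ^ 2 : ℝ) : ℂ)) * Vᴴ) := by
    have hd : (Matrix.diagonal (fun i => (e i : ℂ)))ᴴ * Matrix.diagonal (fun i => (e i : ℂ)) =
        Matrix.diagonal (fun i => ((e i ^ 2 : ℝ) : ℂ)) := by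
      rw [Matrix.diagonal_conjTranspose, Matrix.diagonal_mul_diagonal]
      congr 1
      ext i
      simp [sq]
    rw [← hd]
    simp only [Matrix.conjTranspose_mul, Matrix.conjTranspose_conjTranspose, Matrix.mul_assoc]
    rw [← Matrix.mul_assoc Wᴴ W, hW, Matrix.one_mul]
  rw [h, Matrix.trace_mul_comm, Matrix.mul_assoc, hV, Matrix.mul_one, Matrix.trace_diagonal,
    ← Complex.ofReal_sum]
  exact_mod_cast Complex.ofReal_re _

/-- For every complex n×n matrix M there exists a unitary R with
    ‖M − R‖₂,τ ≤ ‖M*M − 1‖₂,τ. -/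
theorem matrix_close_to_unitary (n : ℕ) (M : Matrix (Fin n) (Fin n) ℂ) :
    ∃ R ∈ Matrix.unitaryGroup (Fin n) ℂ,
      hsnorm (M - R) ≤ hsnorm (Mᴴ * M - 1) := by
  obtain ⟨W, hW, V, hV, d, hd, h⟩ := svd_aux n M
  have hW' : Wᴴ * W = 1 := Matrix.mem_unitaryGroup_iff'.1 hW
  have hV' : Vᴴ * V = 1 := Matrix.mem_unitaryGroup_iff'.1 hV
  have hV2 : V * Vᴴ = 1 := Matrix.mem_unitaryGroup_iff.1 hV
  refine ⟨W * Vᴴ, mul_mem hW (Unitary.star_mem hV), ?_⟩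
  have hM : M = W * Matrix.diagonal (fun i => (d i : ℂ)) * Vᴴ := by
    rw [← h, Matrix.mul_assoc, hV2, Matrix.mul_one]
  have h1 : M - W * Vᴴ = W * Matrix.diagonal (fun i => ((d i - 1 : ℝ) : ℂ)) * Vᴴ := by
    have : Matrix.diagonal (fun i => ((d i - 1 : ℝ) : ℂ)) =
        Matrix.diagonal (fun i => (d i : ℂ)) - 1 := by
      rw [← Matrix.diagonal_one, Matrix.diagonal_sub]
      simp
    rw [this, Matrix.mul_sub, Matrix.sub_mul, Matrix.mul_one, ← hM]
  have h2 : Mᴴ * M - 1 = V * Matrix.diagonal (fun i => ((d i ^ 2 - 1 : ℝ) : ℂ)) * Vᴴ := by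
    have : Matrix.diagonal (fun i => ((d i ^ 2 - 1 : ℝ) : ℂ)) =
        (Matrix.diagonal (fun i => (d i : ℂ)))ᴴ * Matrix.diagonal (fun i => (d i : ℂ)) - 1 := by
      rw [← Matrix.diagonal_one, Matrix.diagonal_conjTranspose, Matrix.diagonal_mul_diagonal,
        Matrix.diagonal_sub]
      congr 1
      ext i
      simp [sq]
    rw [this, Matrix.mul_sub, Matrix.sub_mul, Matrix.mul_one, hV2, hM]
    congr 1
    simp only [Matrix.conjTranspose_mul, Matrix.conjTranspose_conjTranspose, Matrix.mul_assoc]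
    rw [← Matrix.mul_assoc Wᴴ W, hW', Matrix.one_mul]
  rw [h1, h2, trace_aux n W V hW' hV', trace_aux n V V hV' hV']
  apply Real.sqrt_le_sqrt
  refine div_le_div_of_nonneg_right (Finset.sum_le_sum fun i _ => ?_) (Nat.cast_nonneg n)
  have := hd i
  have e : (d i ^ 2 - 1) ^ 2 - (d i - 1) ^ 2 = (d i - 1) ^ 2 * (d i * (d i + 2)) := by ring
  have : 0 ≤ (d i - 1) ^ 2 * (d i * (d i + 2)) := by positivity
  linarith
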